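/- If Φ(x,x) ≥ 0 for all x ∈ X, Φ(x,·) is convex for every x ∈ X, and Φ(·,x) is continuous for every x ∈ X, then EP(X,Φ) has at least one solution: there exists x* ∈ X with Φ(x*,x) ≥ 0 for all x ∈ X. -/

import Mathlib

open scoped RealInnerProductSpace

open MeasureTheory Set

/-- `t ↦ det (1 - t A)` is a polynomial of degree at most the dimension. -/
lemma det_poly {E : Type*} [NormedAddCommGroup E] [InnerProductSpace ℝ E] [FiniteDimensional ℝ E]
    (A : E →L[ℝ] E) : ∃ q : Polynomial ℝ, q.natDegree ≤ Module.finrank ℝ E ∧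
      ∀ t : ℝ, q.eval t = (ContinuousLinearMap.id ℝ E - t • A).det := by
  classical
  let b := Module.finBasis ℝ E
  let M := LinearMap.toMatrix b b (A : E →ₗ[ℝ] E)
  refine ⟨((Polynomial.X : Polynomial ℝ) • (-M).map (Polynomial.C : ℝ →+* Polynomial ℝ) +
    (1 : Matrix (Fin (Module.finrank ℝ E)) (Fin (Module.finrank ℝ E)) ℝ).map (Polynomial.C : ℝ →+* Polynomial ℝ)).det, ?_, ?_⟩
  · simpa using Polynomial.natDegree_det_X_add_C_le (-M) 1
  · intro t
    rw [ContinuousLinearMap.det, ← LinearMap.det_toMatrix b, ← Polynomial.coe_evalRingHom,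
      RingHom.map_det]
    congr 1
    ext i j
    by_cases hij : i = j
    · subst hij
      simp [M, LinearMap.toMatrix_apply]
      ring
    · simp [M, LinearMap.toMatrix_apply, hij]
      ring

/-- For small `t`, `x ↦ x - t h x` satisfies the change of variables formula on the ball. -/
lemma small_t {E : Type*} [NormedAddCommGroup E] [InnerProductSpace ℝ E] [FiniteDimensional ℝ E]
    [MeasurableSpace E] [BorelSpace E]
    (h : E → E) (hh : ContDiff ℝ 1 h) (hc : HasCompactSupport h) (R : ℝ)
    (hR : ∀ x, x ∉ Metric.closedBall (0 : E) R → h x = 0) :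
    ∃ δ > 0, ∀ t ∈ Ioo (0 : ℝ) δ, ∀ φ : E → ℝ,
      ∫ x in Metric.closedBall (0 : E) R,
        (ContinuousLinearMap.id ℝ E - t • fderiv ℝ h x).det * φ (x - t • h x)
        = ∫ x in Metric.closedBall (0 : E) R, φ x := by
  obtain ⟨K, hK⟩ := hh.lipschitzWith_of_hasCompactSupport hc one_ne_zero
  have hdet : ∃ ε > 0, ∀ A : E →L[ℝ] E, ‖A‖ < ε → 0 < (ContinuousLinearMap.id ℝ E - A).det := by
    have hcont : Continuous fun A : E →L[ℝ] E => (ContinuousLinearMap.id ℝ E - A).det :=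
      ContinuousLinearMap.continuous_det.comp (continuous_const.sub continuous_id)
    have h1 : ∀ᶠ A in nhds (0 : E →L[ℝ] E), 0 < (ContinuousLinearMap.id ℝ E - A).det := by
      apply hcont.continuousAt.eventually_const_lt
      simp [ContinuousLinearMap.det]
    obtain ⟨ε, hε, H⟩ := Metric.eventually_nhds_iff.1 h1
    exact ⟨ε, hε, fun A hA => H (by simpa using hA)⟩
  obtain ⟨ε, hε, hpos⟩ := hdet
  have hK0 : (0 : ℝ) ≤ K := K.2
  refine ⟨min 1 ε / (K + 1), by positivity, ?_⟩
  intro t ht φ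
  have ht0 := ht.1
  have htK : t * (K + 1) < min 1 ε := by
    have := ht.2
    rwa [lt_div_iff₀ (by positivity)] at this
  have htK1 : t * K < 1 := by nlinarith [min_le_left 1 ε]
  have htKe : t * K < ε := by nlinarith [min_le_right 1 ε]
  let f : E → E := fun x => x - t • h x
  have hcw : ∀ y : E, ContractingWith (Real.toNNReal t * K) (fun x => y + t • h x) := by
    intro y
    refine ⟨?_, ?_⟩
    · rw [← NNReal.coe_lt_coe, NNReal.coe_mul, Real.coe_toNNReal t ht0.le]; exact htK1
    · apply LipschitzWith.of_dist_le_mul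
      intro a b
      rw [dist_add_left, dist_smul₀]
      have := hK.dist_le_mul a b
      simp only [NNReal.coe_mul, Real.coe_toNNReal t ht0.le, Real.norm_eq_abs, abs_of_pos ht0]
      rw [mul_assoc]
      exact mul_le_mul_of_nonneg_left this ht0.le
  have hinj : Function.Injective f := by
    intro a b hab
    apply (hcw (f a)).fixedPoint_unique' (x := a) (y := b)
    · simp [Function.IsFixedPt, f]
    · rw [hab]; simp [Function.IsFixedPt, f]
  have hsurj : Function.Surjective f := by
    intro y
    refine ⟨ContractingWith.fixedPoint _ (hcw y), ?_⟩
    have := (hcw y).fixedPoint_isFixedPt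
    simp only [Function.IsFixedPt] at this
    simp only [f]
    rw [sub_eq_iff_eq_add]
    exact this.symm
  have hout : ∀ x, x ∉ Metric.closedBall (0 : E) R → f x = x := by
    intro x hx; simp [f, hR x hx]
  have himg : f '' Metric.closedBall (0 : E) R = Metric.closedBall (0 : E) R := by
    ext y
    constructor
    · rintro ⟨x, hx, rfl⟩
      by_contra hy
      have := hinj (hout _ hy)
      rw [this] at hy
      exact hy hx
    · intro hy
      obtain ⟨x, rfl⟩ := hsurj y
      refine ⟨x, ?_, rfl⟩
      by_contra hx
      rw [hout x hx] at hy
      exact hx hy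
  have hder : ∀ x ∈ Metric.closedBall (0 : E) R, HasFDerivWithinAt f
      (ContinuousLinearMap.id ℝ E - t • fderiv ℝ h x) (Metric.closedBall (0 : E) R) x := by
    intro x _
    have h1 : HasFDerivAt h (fderiv ℝ h x) x :=
      ((hh.differentiable one_ne_zero) x).hasFDerivAt
    exact ((hasFDerivAt_id x).sub (h1.const_smul t)).hasFDerivWithinAt
  have key := integral_image_eq_integral_abs_det_fderiv_smul volume
    Metric.isClosed_closedBall.measurableSet hder hinj.injOn φ
  rw [himg] at key
  rw [key]
  congr 1
  ext x
  rw [abs_of_pos]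
  · rfl
  · apply hpos
    rw [norm_smul, Real.norm_eq_abs, abs_of_pos ht0]
    refine lt_of_le_of_lt ?_ htKe
    exact mul_le_mul_of_nonneg_left (norm_fderiv_le_of_lipschitz ℝ hK) ht0.le

/-- The degree formula at `t = 1` for radial polynomial test functions. -/
lemma poly_int {E : Type*} [NormedAddCommGroup E] [InnerProductSpace ℝ E] [FiniteDimensional ℝ E]
    [MeasurableSpace E] [BorelSpace E]
    (h : E → E) (hh : ContDiff ℝ 1 h) (hc : HasCompactSupport h) (R : ℝ)
    (hR : ∀ x, x ∉ Metric.closedBall (0 : E) R → h x = 0) (p : Polynomial ℝ) :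
      ∫ x in Metric.closedBall (0 : E) R,
        (ContinuousLinearMap.id ℝ E - fderiv ℝ h x).det * p.eval (‖x - h x‖ ^ 2)
        = ∫ x in Metric.closedBall (0 : E) R, p.eval (‖x‖ ^ 2) := by
  classical
  obtain ⟨δ, hδ, H⟩ := small_t h hh hc R hR
  let N := Module.finrank ℝ E + p.natDegree * 2
  obtain ⟨s, hs, hcard⟩ := (Ioo_infinite hδ).exists_subset_card_eq (N + 1)
  let F : ℝ → E → ℝ := fun t x =>
    (ContinuousLinearMap.id ℝ E - t • fderiv ℝ h x).det * p.eval (‖x - t • h x‖ ^ 2)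
  have hpoly : ∀ x, ∃ q : Polynomial ℝ, q.natDegree ≤ N ∧ ∀ t, q.eval t = F t x := by
    intro x
    obtain ⟨q, hq, hq'⟩ := det_poly (fderiv ℝ h x)
    let r : Polynomial ℝ := Polynomial.C (‖h x‖ ^ 2) * Polynomial.X ^ 2 +
      Polynomial.C (- 2 * ⟪x, h x⟫) * Polynomial.X + Polynomial.C (‖x‖ ^ 2)
    refine ⟨q * p.comp r, ?_, ?_⟩
    · refine Polynomial.natDegree_mul_le.trans (add_le_add hq ?_)
      refine Polynomial.natDegree_comp_le.trans ?_
      exact Nat.mul_le_mul_left _ Polynomial.natDegree_quadratic_le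
    · intro t
      simp only [F, Polynomial.eval_mul, hq', Polynomial.eval_comp]
      congr 2
      rw [norm_sub_sq_real, inner_smul_right, norm_smul, mul_pow, Real.norm_eq_abs, sq_abs]
      simp [r]
      ring
  let L : ℝ → ℝ := fun i => (Lagrange.basis s id i).eval 1
  have hL : ∑ i ∈ s, L i = 1 := by
    have := congrArg (Polynomial.eval 1) (Lagrange.sum_basis (s := s) (v := (id : ℝ → ℝ))
      (Function.injective_id.injOn) (Finset.card_pos.1 (by omega)))
    simpa [Polynomial.eval_finset_sum] using this
  have hF : ∀ x, F 1 x = ∑ i ∈ s, L i * F i x := by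
    intro x
    obtain ⟨q, hq, hq'⟩ := hpoly x
    have hd : q.degree < s.card := by
      refine lt_of_le_of_lt Polynomial.degree_le_natDegree ?_
      rw [hcard]; exact_mod_cast Nat.lt_succ_of_le hq
    have := congrArg (Polynomial.eval 1) (Lagrange.eq_interpolate (s := s) (v := (id : ℝ → ℝ))
      (Function.injective_id.injOn) hd)
    rw [Lagrange.interpolate_apply, Polynomial.eval_finset_sum, hq'] at this
    rw [this]
    refine Finset.sum_congr rfl fun i _ => ?_
    simp [L, hq', mul_comm]
  have hcontF : ∀ t, Continuous (F t) := by
    intro t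
    have h1 := hh.continuous_fderiv one_ne_zero
    have h2 := hh.continuous
    refine (ContinuousLinearMap.continuous_det.comp
      (continuous_const.sub (h1.const_smul t))).mul (p.continuous.comp ?_)
    fun_prop
  have hint : ∀ t, IntegrableOn (F t) (Metric.closedBall (0 : E) R) := fun t =>
    (hcontF t).continuousOn.integrableOn_compact (isCompact_closedBall _ _)
  calc _ = ∫ x in Metric.closedBall (0 : E) R, F 1 x := by simp [F]
    _ = ∫ x in Metric.closedBall (0 : E) R, ∑ i ∈ s, L i * F i x := by simp only [hF]
    _ = ∑ i ∈ s, L i * ∫ x in Metric.closedBall (0 : E) R, F i x := by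
      rw [integral_finset_sum _ fun i _ => (hint i).const_mul (L i)]
      simp only [integral_const_mul]
    _ = ∑ i ∈ s, L i * ∫ x in Metric.closedBall (0 : E) R, p.eval (‖x‖ ^ 2) := by
      refine Finset.sum_congr rfl fun i hi => ?_
      rw [← H i (hs hi) (fun x => p.eval (‖x‖ ^ 2))]
    _ = _ := by rw [← Finset.sum_mul, hL, one_mul]

/-- Compactly supported `C¹` maps have a fixed point. -/
lemma fixed_cpt {E : Type*} [NormedAddCommGroup E] [InnerProductSpace ℝ E] [FiniteDimensional ℝ E]
    (h : E → E) (hh : ContDiff ℝ 1 h) (hc : HasCompactSupport h) : ∃ x, h x = x := by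
  letI : MeasurableSpace E := borel E
  haveI : BorelSpace E := ⟨rfl⟩
  by_contra hno
  push Not at hno
  obtain ⟨R, hRpos, hRs⟩ := hc.isCompact.isBounded.subset_closedBall_lt 0 (0 : E)
  have hR : ∀ x, x ∉ Metric.closedBall (0 : E) R → h x = 0 := fun x hx =>
    image_eq_zero_of_notMem_tsupport fun hx' => hx (hRs hx')
  have key := poly_int h hh hc R hR
  set B := Metric.closedBall (0 : E) R with hB
  have hBc : IsCompact B := isCompact_closedBall _ _
  have h0B : (0 : E) ∈ B := by simp [hB, hRpos.le]
  have hcn : Continuous fun x => ‖x - h x‖ ^ 2 := by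
    have := hh.continuous
    fun_prop
  obtain ⟨x0, hx0, hmin⟩ := hBc.exists_isMinOn ⟨0, h0B⟩ hcn.continuousOn
  obtain ⟨x1, hx1, hmax⟩ := hBc.exists_isMaxOn ⟨0, h0B⟩ hcn.continuousOn
  set ε := ‖x0 - h x0‖ ^ 2 with hε
  have hεpos : 0 < ε := by
    have : x0 - h x0 ≠ 0 := sub_ne_zero.2 (hno x0).symm
    positivity
  set M := max (‖x1 - h x1‖ ^ 2) (R ^ 2) with hM
  let ψ : ℝ → ℝ := fun s => max 0 (ε - s)
  have hψ : Continuous ψ := by fun_prop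
  let D : E → ℝ := fun x => (ContinuousLinearMap.id ℝ E - fderiv ℝ h x).det
  have hD : Continuous D := ContinuousLinearMap.continuous_det.comp
      (continuous_const.sub (hh.continuous_fderiv one_ne_zero))
  obtain ⟨x2, hx2, hDmax⟩ := hBc.exists_isMaxOn ⟨0, h0B⟩ hD.abs.continuousOn
  set c := ∫ x in B, ψ (‖x‖ ^ 2) with hcdef
  have hψn : Continuous fun x : E => ψ (‖x‖ ^ 2) := by fun_prop
  have hcpos : 0 < c := by
    rw [hcdef, setIntegral_pos_iff_support_of_nonneg_ae]
    · refine lt_of_lt_of_le ?_ (measure_mono (inter_subset_inter_right _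
        (Metric.ball_subset_closedBall)))
      refine IsOpen.measure_pos _ (IsOpen.inter ?_ Metric.isOpen_ball) ⟨0, ?_, ?_⟩
      · exact hψn.isOpen_support
      · simp [ψ, hεpos.not_ge, hεpos]
      · simp [hRpos]
    · exact Filter.Eventually.of_forall fun x => le_max_left _ _
    · exact hψn.continuousOn.integrableOn_compact hBc
  have hvol : volume B < ⊤ := hBc.measure_lt_top
  set V := volume.real B
  have hV : 0 ≤ V := measureReal_nonneg
  obtain ⟨p, hp⟩ := exists_polynomial_near_of_continuousOn 0 M ψ hψ.continuousOn
    (c / (2 * ((|D x2| + 1) * V + 1))) (by positivity)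
  set η := c / (2 * ((|D x2| + 1) * V + 1)) with hη
  have hηpos : 0 < η := by positivity
  have e1 : ‖∫ x in B, D x * p.eval (‖x - h x‖ ^ 2)‖ ≤ |D x2| * η * V := by
    apply norm_setIntegral_le_of_norm_le_const hvol
    intro x hx
    rw [norm_mul, Real.norm_eq_abs, Real.norm_eq_abs]
    have h1 := hp (‖x - h x‖ ^ 2) ⟨by positivity, (hmax hx).trans (le_max_left _ _)⟩
    have h2 : ψ (‖x - h x‖ ^ 2) = 0 := max_eq_left (sub_nonpos.2 (hmin hx))
    rw [h2, sub_zero] at h1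
    exact mul_le_mul (hDmax hx) h1.le (abs_nonneg _) (abs_nonneg _)
  have hpn : Continuous fun x : E => p.eval (‖x‖ ^ 2) := p.continuous.comp (by fun_prop)
  have e2 : ‖∫ x in B, (p.eval (‖x‖ ^ 2) - ψ (‖x‖ ^ 2))‖ ≤ η * V := by
    apply norm_setIntegral_le_of_norm_le_const hvol
    intro x hx
    have hxR : ‖x‖ ≤ R := by simpa [hB] using hx
    exact (hp (‖x‖ ^ 2) ⟨by positivity,
      (pow_le_pow_left₀ (norm_nonneg _) hxR 2).trans (le_max_right _ _)⟩).le
  rw [integral_sub (hpn.continuousOn.integrableOn_compact hBc)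
    (hψn.continuousOn.integrableOn_compact hBc), ← key p] at e2
  rw [Real.norm_eq_abs] at e1 e2
  have h3 : c ≤ η * ((|D x2| + 1) * V) := by
    have a1 := (abs_le.1 e1).2
    have a2 := (abs_le.1 e2).1
    change -(η * V) ≤ (∫ x in B, D x * p.eval (‖x - h x‖ ^ 2)) - c at a2
    linarith
  have h4 : η * (2 * ((|D x2| + 1) * V + 1)) = c := by
    rw [hη]; field_simp
  nlinarith [mul_nonneg hηpos.le (mul_nonneg (add_nonneg (abs_nonneg (D x2)) zero_le_one) hV)]

/-- Bounded `C¹` maps have a fixed point. -/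
lemma fixed_bdd {E : Type*} [NormedAddCommGroup E] [InnerProductSpace ℝ E] [FiniteDimensional ℝ E]
    (g : E → E) (hg : ContDiff ℝ 1 g) (R : ℝ) (hR : ∀ x, ‖g x‖ ≤ R) : ∃ x, g x = x := by
  have hR0 : 0 ≤ R := (norm_nonneg _).trans (hR 0)
  let χ : ContDiffBump (0 : E) := ⟨R + 1, R + 2, by linarith, by linarith⟩
  obtain ⟨x, hx⟩ := fixed_cpt (fun x => χ x • g x) (χ.contDiff.smul hg)
    (χ.hasCompactSupport.smul_right)
  refine ⟨x, ?_⟩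
  have h1 : ‖x‖ ≤ R := by
    rw [← hx, norm_smul, Real.norm_eq_abs, abs_of_nonneg χ.nonneg]
    exact (mul_le_of_le_one_left (norm_nonneg _) χ.le_one).trans (hR x)
  have h2 : χ x = 1 := χ.one_of_mem_closedBall (by
    simp only [Metric.mem_closedBall, dist_zero_right]
    change ‖x‖ ≤ R + 1
    linarith)
  simpa [h2] using hx

/-- If `Φ(x,x) ≥ 0` for all `x ∈ X`, `Φ(x,·)` is convex for every
`x ∈ X`, and `Φ(·,x)` is continuous for every `x ∈ X`, then EP(X,Φ) has at least
one solution. -/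
theorem stmt_3
    {E : Type*} [NormedAddCommGroup E] [InnerProductSpace ℝ E] [FiniteDimensional ℝ E]
    (X : Set E) (hXne : X.Nonempty) (hXcp : IsCompact X) (hXcv : Convex ℝ X)
    (Φ : E → E → ℝ)
    (hdiag : ∀ x ∈ X, 0 ≤ Φ x x)
    (hconv : ∀ x ∈ X, ConvexOn ℝ X (Φ x))
    (hcont : ∀ x ∈ X, ContinuousOn (fun y => Φ y x) X) :
    ∃ xs ∈ X, ∀ x ∈ X, 0 ≤ Φ xs x := by
  by_contra hno
  push Not at hno
  let T : E → Set E := fun x => {y | y ∈ X ∧ (x ∈ X → Φ x y < 0)}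
  have hT : ∀ x, Convex ℝ (T x) := by
    intro x
    by_cases hx : x ∈ X
    · simpa [T, hx] using (hconv x hx).convex_lt 0
    · simpa [T, hx] using hXcv
  have hloc : ∀ x, ∃ c, ∀ᶠ y in nhds x, c ∈ T y := by
    intro x
    by_cases hx : x ∈ X
    · obtain ⟨c, hc, hlt⟩ := hno x hx
      refine ⟨c, ?_⟩
      have h1 : ∀ᶠ y in nhdsWithin x X, Φ y c < 0 :=
        (hcont c hc x hx).eventually_lt_const hlt
      filter_upwards [eventually_nhdsWithin_iff.1 h1] with y hy
      exact ⟨hc, hy⟩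
    · obtain ⟨c, hc⟩ := hXne
      refine ⟨c, ?_⟩
      filter_upwards [hXcp.isClosed.isOpen_compl.mem_nhds hx] with y hy
      exact ⟨hc, fun h => absurd h hy⟩
  obtain ⟨g, hg⟩ := exists_contMDiffMap_forall_mem_convex_of_local_const
    (n := 1) (modelWithCornersSelf ℝ E) hT hloc
  obtain ⟨R, hR⟩ := hXcp.isBounded.exists_norm_le
  obtain ⟨x, hx⟩ := fixed_bdd g g.contMDiff.contDiff R fun x => hR _ (hg x).1
  have h1 := hg x
  rw [hx] at h1
  exact absurd (h1.2 h1.1) (not_lt.2 (hdiag x h1.1))
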